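/- arXiv:1109.6398 — 2 statements merged into one kernel-verified Lean document; each statement's English description precedes it below -/
import Mathlib

section
/- Let Λ ⊆ ℤⁿ be a lattice and S ∈ GL_n(ℝ). Then det(Λ^⊥_S) = |det S| · det(Λ̄_{S^{-t}}), where Λ^⊥ = ℤⁿ ∩ E_Λ^⊥ is the orthogonal lattice, Λ̄ = ℤⁿ ∩ E_Λ, Λ_S = {x·S : x ∈ Λ}, and S^{-t} is the inverse transpose of S. -/
open Finset Matrix

/-- The coordinatewise cast `ℤⁿ → ℚⁿ`, as a `ℤ`-linear map. -/
def coeQ (n : ℕ) : (Fin n → ℤ) →ₗ[ℤ] (Fin n → ℚ) where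
  toFun x := fun j => (x j : ℚ)
  map_add' x y := by funext j; simp
  map_smul' c x := by funext j; push_cast; simp

/-- Matrix heart: the block (Jacobi) computation. -/
theorem aux_jacobi {n r t : ℕ} (S : Matrix (Fin n) (Fin n) ℝ) (hS : IsUnit S.det)
    (D : Matrix (Fin r) (Fin n) ℤ) (E : Matrix (Fin t) (Fin n) ℤ)
    (R : Matrix (Fin n) (Fin t) ℤ) (C : Matrix (Fin r) (Fin n) ℤ)
    (h1 : R * E + Dᵀ * C = 1) (hER : E * R = 1) (hED : E * Dᵀ = 0)
    (hCR : C * R = 0) (hCD : C * Dᵀ = 1) :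
    Real.sqrt (((D.map (Int.cast : ℤ → ℝ)) * S * ((D.map (Int.cast : ℤ → ℝ)) * S)ᵀ).det)
      = |S.det| *
        Real.sqrt (((E.map (Int.cast : ℤ → ℝ)) * S⁻¹ᵀ *
          ((E.map (Int.cast : ℤ → ℝ)) * S⁻¹ᵀ)ᵀ).det) := by
  set W : Matrix (Fin n) (Fin t ⊕ Fin r) ℤ := fromCols R Dᵀ with hW
  set X : Matrix (Fin t ⊕ Fin r) (Fin n) ℤ := fromRows E C with hX
  have hWX : W * X = 1 := by rw [hW, hX, fromCols_mul_fromRows, h1]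
  have hXW : X * W = 1 := by
    rw [hW, hX, fromRows_mul_fromCols, hER, hED, hCR, hCD, fromBlocks_one]
  set c := Int.castRingHom ℝ with hc
  have hWXr : W.map c * X.map c = 1 := by
    rw [← Matrix.map_mul, hWX, Matrix.map_one _ (map_zero c) (map_one c)]
  have hXWr : X.map c * W.map c = 1 := by
    rw [← Matrix.map_mul, hXW, Matrix.map_one _ (map_zero c) (map_one c)]
  set Dr := D.map c with hDr
  set Er := E.map c with hEr
  set Cr := C.map c with hCr
  set Rr := R.map c with hRr
  have hXr : X.map c = fromRows Er Cr := by
    ext i j; rcases i with i | i <;> simp [hX, hEr, hCr]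
  have hWr : W.map c = fromCols Rr Drᵀ := by
    ext i j; rcases j with j | j <;> simp [hW, hRr, hDr]
  have hd : ((X.map c)ᵀ * X.map c).det = 1 := by
    have e1 : (X.map c)ᵀ * X.map c = (Xᵀ * X).map c := by
      rw [Matrix.map_mul, transpose_map]
    have hu : IsUnit (Xᵀ * X).det := by
      have : (Xᵀ * X) * (W * Wᵀ) = 1 := by
        rw [Matrix.mul_assoc, ← Matrix.mul_assoc X, hXW, Matrix.one_mul, ← transpose_mul, hWX,
          transpose_one]
      exact IsUnit.of_mul_eq_one _ (by rw [← det_mul, this, det_one])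
    have hnn : 0 ≤ ((X.map c)ᵀ * X.map c).det := by
      have := (posSemidef_conjTranspose_mul_self (X.map c)).det_nonneg
      simpa [conjTranspose_eq_transpose_of_trivial] using this
    have e2 : ((X.map c)ᵀ * X.map c).det = ((Xᵀ * X).det : ℝ) := by
      rw [e1]; exact ((c.map_det _).symm)
    rw [e2] at hnn ⊢
    rcases Int.isUnit_iff.1 hu with h | h
    · rw [h]; simp
    · rw [h] at hnn; norm_num at hnn
  have hS1 : S * S⁻¹ = 1 := mul_nonsing_inv S hS
  have hS2 : S⁻¹ * S = 1 := nonsing_inv_mul S hS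
  set M := S⁻¹ᵀ * S⁻¹ with hM
  set N := S * Sᵀ with hN
  have hMN : M * N = 1 := by
    rw [hM, hN, Matrix.mul_assoc, ← Matrix.mul_assoc S⁻¹, hS2, Matrix.one_mul, ← transpose_mul,
      hS1, transpose_one]
  have hGH : (X.map c * M * (X.map c)ᵀ) * ((W.map c)ᵀ * N * W.map c) = 1 := by
    calc _ = X.map c * M * ((W.map c * X.map c)ᵀ) * N * W.map c := by
            rw [transpose_mul]; simp only [Matrix.mul_assoc]
      _ = X.map c * (M * N) * W.map c := by
            rw [hWXr, transpose_one]; simp only [Matrix.mul_assoc, Matrix.one_mul]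
      _ = 1 := by rw [hMN, Matrix.mul_one, hXWr]
  have hdetG : (X.map c * M * (X.map c)ᵀ).det = M.det := by
    rw [Matrix.mul_assoc, det_comm' hXWr hWXr, Matrix.mul_assoc, det_mul, hd, mul_one]
  have hG : X.map c * M * (X.map c)ᵀ =
      fromBlocks (Er * M * Erᵀ) (Er * M * Crᵀ) (Cr * M * Erᵀ) (Cr * M * Crᵀ) := by
    rw [hXr, transpose_fromRows, fromRows_mul, fromRows_mul_fromCols]
  have hH : (W.map c)ᵀ * N * W.map c =
      fromBlocks (Rrᵀ * N * Rr) (Rrᵀ * N * Drᵀ) (Dr * N * Rr) (Dr * N * Drᵀ) := by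
    rw [hWr, transpose_fromCols, fromRows_mul, fromRows_mul_fromCols, transpose_transpose]
  have hdetM : M.det * (S.det * S.det) = 1 := by
    have := congrArg det hMN
    rwa [det_mul, hN, det_mul S, det_transpose, det_one] at this
  have key : M.det * (Dr * N * Drᵀ).det = (Er * M * Erᵀ).det := by
    rw [hG, hH, fromBlocks_multiply, ← fromBlocks_one, fromBlocks_inj] at hGH
    obtain ⟨-, g12, -, g22⟩ := hGH
    have : fromBlocks (Er * M * Erᵀ) (Er * M * Crᵀ) (Cr * M * Erᵀ) (Cr * M * Crᵀ) *
        fromBlocks 1 (Rrᵀ * N * Drᵀ) 0 (Dr * N * Drᵀ) =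
        fromBlocks (Er * M * Erᵀ) 0 (Cr * M * Erᵀ) 1 := by
      rw [fromBlocks_multiply, g12, g22]; simp
    have := congrArg det this
    rw [det_mul, ← hG, hdetG, det_fromBlocks_zero₂₁, det_fromBlocks_zero₁₂, det_one, det_one, one_mul,
      mul_one] at this
    exact this
  have eD : D.map (Int.cast : ℤ → ℝ) * S * (D.map (Int.cast : ℤ → ℝ) * S)ᵀ = Dr * N * Drᵀ := by
    change Dr * S * (Dr * S)ᵀ = _
    rw [transpose_mul, hN]; simp only [Matrix.mul_assoc]
  have eE : E.map (Int.cast : ℤ → ℝ) * S⁻¹ᵀ * (E.map (Int.cast : ℤ → ℝ) * S⁻¹ᵀ)ᵀ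
      = Er * M * Erᵀ := by
    change Er * S⁻¹ᵀ * (Er * S⁻¹ᵀ)ᵀ = _
    rw [transpose_mul, transpose_transpose, hM]; simp only [Matrix.mul_assoc]
  rw [eD, eE]
  have : (Dr * N * Drᵀ).det = S.det ^ 2 * (Er * M * Erᵀ).det := by
    rw [← key]
    linear_combination (-(Dr * N * Drᵀ).det) * hdetM
  rw [this, Real.sqrt_mul (sq_nonneg _), Real.sqrt_sq_eq_abs]

/-- A saturated sublattice basis admits an integral right inverse. -/
theorem aux_rightInv {n t : ℕ} (E : Matrix (Fin t) (Fin n) ℤ)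
    (hE₁ : LinearIndependent ℤ fun i => E i)
    (hsat : ∀ (a : ℤ) (x : Fin n → ℤ), a ≠ 0 →
      a • x ∈ Submodule.span ℤ (Set.range fun i => E i) →
      x ∈ Submodule.span ℤ (Set.range fun i => E i)) :
    ∃ R : Matrix (Fin n) (Fin t) ℤ, E * R = 1 := by
  set L := Submodule.span ℤ (Set.range fun i => E i) with hL
  have : Module.IsTorsionFree ℤ ((Fin n → ℤ) ⧸ L) := by
    refine Module.IsTorsionFree.of_smul_eq_zero fun a y h => ?_
    obtain ⟨x, rfl⟩ := L.mkQ_surjective y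
    by_cases ha : a = 0
    · exact Or.inl ha
    · right
      rw [← map_smul] at h
      simp only [Submodule.mkQ_apply, Submodule.Quotient.mk_eq_zero] at h ⊢
      exact hsat a x ha h
  have : Module.Free ℤ ((Fin n → ℤ) ⧸ L) := Module.free_of_finite_type_torsion_free'
  obtain ⟨s, hs⟩ := Module.projective_lifting_property L.mkQ LinearMap.id L.mkQ_surjective
  let p : (Fin n → ℤ) →ₗ[ℤ] L := LinearMap.codRestrict L (LinearMap.id - s ∘ₗ L.mkQ) (by
    intro x
    rw [← Submodule.Quotient.mk_eq_zero, ← Submodule.mkQ_apply]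
    have := LinearMap.congr_fun hs (L.mkQ x)
    simp only [LinearMap.comp_apply, LinearMap.id_apply] at this
    simp only [LinearMap.sub_apply, LinearMap.comp_apply, LinearMap.id_apply, map_sub, this,
      sub_self])
  let b := Module.Basis.span hE₁
  have hmem : ∀ i, E i ∈ L := fun i => Submodule.subset_span ⟨i, rfl⟩
  have hp : ∀ i, p (E i) = b i := by
    intro i
    apply Subtype.ext
    have h0 : L.mkQ (E i) = 0 := by simpa using hmem i
    have : (b i : Fin n → ℤ) = E i :=
      congrArg Subtype.val (Module.Basis.span_apply hE₁ i)
    rw [this]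
    simp only [p, LinearMap.codRestrict_apply, LinearMap.sub_apply, LinearMap.comp_apply, h0,
      map_zero, sub_zero, LinearMap.id_apply]
  let q : (Fin n → ℤ) →ₗ[ℤ] (Fin t → ℤ) := b.equivFun.toLinearMap ∘ₗ p
  refine ⟨(LinearMap.toMatrix' q)ᵀ, ?_⟩
  ext i j
  have h1 : (LinearMap.toMatrix' q) *ᵥ (E i) = q (E i) := LinearMap.toMatrix'_mulVec q (E i)
  have h2 := congrFun h1 j
  have h3 : q (E i) = Pi.single i 1 := by
    simp only [q, LinearMap.comp_apply, hp]
    ext j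
    simp [Module.Basis.equivFun_apply, Finsupp.single_apply, Pi.single_apply, eq_comm]
  rw [h3] at h2
  have : (E * (LinearMap.toMatrix' q)ᵀ) i j = ((LinearMap.toMatrix' q) *ᵥ (E i)) j := by
    simp only [Matrix.mul_apply, mulVec, dotProduct, transpose_apply]
    exact Finset.sum_congr rfl fun _ _ => mul_comm _ _
  rw [this, h2, Matrix.one_apply, Pi.single_apply]
  simp [eq_comm]

/-- Lemma 3.3: let `Λ ⊆ ℤⁿ` be a lattice (with basis matrix `B`) and `S ∈ GL_n(ℝ)`.  Then
`det(Λ^⊥_S) = |det S| · det(Λ̄_{S^{-t}})`, where `Λ^⊥ = ℤⁿ ∩ E_Λ^⊥` is the orthogonal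
lattice, `Λ̄ = ℤⁿ ∩ E_Λ`, `Λ_S = {x·S : x ∈ Λ}`, and `S^{-t}` is the inverse transpose of
`S`.  The determinant of a lattice is computed from an arbitrary basis matrix (`D` for
`Λ^⊥` and `E` for `Λ̄`) as the square root of the Gram determinant. -/
theorem det_orthogonal_lattice_scaled {k n : ℕ} (B : Matrix (Fin k) (Fin n) ℤ)
    (hB : LinearIndependent ℚ fun i => fun j => ((B i j : ℚ)))
    (S : Matrix (Fin n) (Fin n) ℝ) (hS : IsUnit S.det)
    {r t : ℕ} (D : Matrix (Fin r) (Fin n) ℤ) (E : Matrix (Fin t) (Fin n) ℤ)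
    (hD₁ : LinearIndependent ℤ fun i => D i)
    (hD₂ : Submodule.span ℤ (Set.range fun i => D i) = LinearMap.ker B.mulVecLin)
    (hE₁ : LinearIndependent ℤ fun i => E i)
    (hE₂ : Submodule.span ℤ (Set.range fun i => E i) =
      Submodule.comap (coeQ n)
        ((Submodule.span ℚ (Set.range fun i => fun j => ((B i j : ℚ)))).restrictScalars ℤ)) :
    Real.sqrt (((D.map (Int.cast : ℤ → ℝ)) * S * ((D.map (Int.cast : ℤ → ℝ)) * S)ᵀ).det)
      = |S.det| *
        Real.sqrt (((E.map (Int.cast : ℤ → ℝ)) * S⁻¹ᵀ *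
          ((E.map (Int.cast : ℤ → ℝ)) * S⁻¹ᵀ)ᵀ).det) := by
  have hmemE : ∀ x : Fin n → ℤ, x ∈ Submodule.span ℤ (Set.range fun i => E i) ↔
      (fun j => (x j : ℚ)) ∈ Submodule.span ℚ (Set.range fun i => fun j => ((B i j : ℚ))) := by
    intro x; rw [hE₂]; rfl
  obtain ⟨R, hER⟩ := aux_rightInv E hE₁ (by
    intro a x ha h
    rw [hmemE] at h ⊢
    have hh := Submodule.smul_mem _ ((a : ℚ)⁻¹) h
    convert hh using 1
    ext j
    have : (a : ℚ) ≠ 0 := by exact_mod_cast ha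
    simp [this])
  have hBE : ∀ x : Fin n → ℤ, B *ᵥ x = 0 → E *ᵥ x = 0 := by
    intro x hx
    have hsp : ∀ v ∈ Submodule.span ℚ (Set.range fun i => fun j => ((B i j : ℚ))),
        v ⬝ᵥ (fun j => (x j : ℚ)) = 0 := by
      intro v hv
      induction hv using Submodule.span_induction with
      | mem v hv =>
        obtain ⟨i, rfl⟩ := hv
        have := congrFun hx i
        simp only [mulVec, dotProduct, Pi.zero_apply] at this ⊢
        exact_mod_cast this
      | zero => simp
      | add u v _ _ hu hv => rw [add_dotProduct, hu, hv, add_zero]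
      | smul a v _ hv => rw [smul_dotProduct, hv, smul_zero]
    ext i
    have := hsp _ ((hmemE (E i)).1 (Submodule.subset_span ⟨i, rfl⟩))
    simp only [mulVec, dotProduct, Pi.zero_apply] at this ⊢
    exact_mod_cast this
  have hEB : ∀ x : Fin n → ℤ, E *ᵥ x = 0 → B *ᵥ x = 0 := by
    intro x hx
    have hsp : ∀ v ∈ Submodule.span ℤ (Set.range fun i => E i), v ⬝ᵥ x = 0 := by
      intro v hv
      induction hv using Submodule.span_induction with
      | mem v hv =>
        obtain ⟨i, rfl⟩ := hv
        exact congrFun hx i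
      | zero => simp
      | add u v _ _ hu hv => rw [add_dotProduct, hu, hv, add_zero]
      | smul a v _ hv => rw [smul_dotProduct, hv, smul_zero]
    ext i
    exact hsp (B i) ((hmemE (B i)).2 (Submodule.subset_span ⟨i, rfl⟩))
  have hED : E * Dᵀ = 0 := by
    ext i j
    have h1 : D j ∈ LinearMap.ker B.mulVecLin := hD₂ ▸ Submodule.subset_span ⟨j, rfl⟩
    exact congrFun (hBE (D j) (by simpa using h1)) i
  have hDinj : ∀ {m : ℕ} (Y Z : Matrix (Fin r) (Fin m) ℤ), Dᵀ * Y = Dᵀ * Z → Y = Z := by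
    intro m Y Z h
    have h0 : Dᵀ * (Y - Z) = 0 := by rw [Matrix.mul_sub, h, sub_self]
    ext i j
    have := Fintype.linearIndependent_iff.1 hD₁ (fun i => (Y - Z) i j) (by
      ext l
      have := congrFun (congrFun h0 l) j
      simp only [Matrix.mul_apply, transpose_apply, Matrix.zero_apply] at this
      simp only [Finset.sum_apply, Pi.smul_apply, smul_eq_mul, Pi.zero_apply]
      rw [← this]
      exact Finset.sum_congr rfl fun _ _ => mul_comm _ _) i
    exact sub_eq_zero.1 this
  have hC : ∃ C : Matrix (Fin r) (Fin n) ℤ, Dᵀ * C = 1 - R * E := by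
    have hcol : ∀ j : Fin n, ∃ c : Fin r → ℤ, ∑ i, c i • D i = (1 - R * E)ᵀ j := by
      intro j
      refine (Submodule.mem_span_range_iff_exists_fun ℤ (v := fun i => D i)).1 ?_
      rw [hD₂, LinearMap.mem_ker, mulVecLin_apply]
      apply hEB
      have : E * (1 - R * E) = 0 := by
        rw [Matrix.mul_sub, ← Matrix.mul_assoc, hER, Matrix.one_mul, Matrix.mul_one, sub_self]
      ext i
      exact congrFun (congrFun this i) j
    choose c hc using hcol
    refine ⟨Matrix.of fun i j => c j i, ?_⟩
    ext l j
    have := congrFun (hc j) l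
    simp only [Finset.sum_apply, Pi.smul_apply, smul_eq_mul, transpose_apply] at this
    rw [← this, Matrix.mul_apply]
    simp only [transpose_apply, Matrix.of_apply]
    exact Finset.sum_congr rfl fun _ _ => mul_comm _ _
  obtain ⟨C, hC⟩ := hC
  refine aux_jacobi S hS D E R C (by rw [hC]; abel) hER hED ?_ ?_
  · apply hDinj
    rw [← Matrix.mul_assoc, hC, Matrix.sub_mul, Matrix.mul_assoc, hER]; simp
  · apply hDinj
    rw [← Matrix.mul_assoc, hC, Matrix.sub_mul, Matrix.mul_assoc, hED]; simp
end

section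
/- Let d and k be integers with 1 ≤ k ≤ d, and let c₁,…,c_k ∈ ℤ^{d+1} be linearly independent geometric progressions each with the same ratio m modulo N, where gcd(c_{1,0}, N) = 1. Let L be the lattice they span and S = diag(1, s, …, s^d) for s > 0. Then L^⊥_S has dimension d − k + 1 and det(L^⊥_S) ≤ s^{d(d−k+1)/2} · N^{1−k} · Π_{i=1}^k ‖c_i‖_{2, s^{−1}}. -/
open Finset Matrix

/-- The skewed norm `‖x‖_{2,s⁻¹} = s^{d/2}·(∑ xⱼ² s^{−2j})^{1/2}` of a vector
`x ∈ ℤ^{d+1}`. -/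
noncomputable def vecSkewNormInv (d : ℕ) (x : Fin (d + 1) → ℤ) (s : ℝ) : ℝ :=
  s ^ ((d : ℝ) / 2) * Real.sqrt (∑ j : Fin (d + 1), (x j : ℝ) ^ 2 * (s⁻¹) ^ (2 * (j : ℕ)))

theorem aux_key {n k κ : Type*} [Fintype n] [Fintype k] [Fintype κ] [DecidableEq n] [DecidableEq k]
    [DecidableEq κ] (e : n ⊕ k ≃ κ) (P0 : Matrix n κ ℝ) (E0 B : Matrix k κ ℝ)
    (h : B * P0ᵀ = 0) :
    (P0 * P0ᵀ).det ^ 2 * (B * E0ᵀ).det ^ 2 =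
      (((fromRows P0 E0).submatrix id e).det) ^ 2 * ((P0 * P0ᵀ).det * (B * Bᵀ).det) := by
  have h' : P0 * Bᵀ = 0 := by
    have := congrArg Matrix.transpose h
    simpa using this
  have h1 : ((fromRows P0 B).submatrix id e) * ((fromRows P0 E0).submatrix id e)ᵀ =
      fromBlocks (P0 * P0ᵀ) (P0 * E0ᵀ) 0 (B * E0ᵀ) := by
    rw [transpose_submatrix, submatrix_mul_equiv, transpose_fromRows, fromRows_mul_fromCols, h]
    simp
  have h2 : ((fromRows P0 B).submatrix id e) * ((fromRows P0 B).submatrix id e)ᵀ =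
      fromBlocks (P0 * P0ᵀ) 0 0 (B * Bᵀ) := by
    rw [transpose_submatrix, submatrix_mul_equiv, transpose_fromRows, fromRows_mul_fromCols, h, h']
    simp
  have h1' := congrArg Matrix.det h1
  have h2' := congrArg Matrix.det h2
  rw [det_mul, det_transpose, det_fromBlocks_zero₂₁] at h1' h2'
  rw [← h2', ← mul_pow, ← h1']
  ring

theorem aux_hadamard {k : ℕ} (R : Matrix (Fin k) (Fin k) ℝ) :
    (Rᵀ * R).det ≤ ∏ i, (Rᵀ * R) i i := by
  let b := EuclideanSpace.basisFun (Fin k) ℝ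
  have : Fact (Module.finrank ℝ (EuclideanSpace ℝ (Fin k)) = k) := ⟨by simp⟩
  let o := b.toBasis.orientation
  let v : Fin k → EuclideanSpace ℝ (Fin k) := fun i => WithLp.toLp 2 (fun j => R j i)
  have h := o.abs_volumeForm_apply_le v
  rw [o.volumeForm_robust' b v] at h
  have hd : b.toBasis.det v = R.det := by
    rw [Module.Basis.det_apply]
    congr 1
  rw [hd] at h
  have h2 : |R.det| ^ 2 ≤ (∏ i, ‖v i‖) ^ 2 := by gcongr
  rw [det_mul, det_transpose, ← sq, ← sq_abs]
  refine h2.trans (le_of_eq ?_)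
  rw [← Finset.prod_pow]
  refine Finset.prod_congr rfl fun i _ => ?_
  rw [EuclideanSpace.norm_sq_eq]
  simp [v, Matrix.mul_apply, sq]

open scoped MatrixOrder ComplexOrder Matrix.Norms.L2Operator in
theorem aux_hadamard2 {k : ℕ} {κ : Type*} [Fintype κ] (B : Matrix (Fin k) κ ℝ) :
    (B * Bᵀ).det ≤ ∏ i, (B * Bᵀ) i i := by
  have h : (B * Bᵀ).PosSemidef := by
    have := posSemidef_self_mul_conjTranspose B
    simpa using this
  obtain ⟨R, hR⟩ := CStarAlgebra.nonneg_iff_eq_star_mul_self.mp h.nonneg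
  rw [hR]
  simpa [star_eq_conjTranspose] using aux_hadamard R

theorem aux_dvd {k : ℕ} (hk : 0 < k) (N : ℤ) (G : Matrix (Fin k) (Fin k) ℤ) (u v : Fin k → ℤ)
    (hG : ∀ i j, N ∣ G i j - u i * v j) (hu : Int.gcd (u ⟨0, hk⟩) N = 1) :
    N ^ (k - 1) ∣ G.det := by
  set z : Fin k := ⟨0, hk⟩
  obtain ⟨a, ha⟩ : ∃ a, N ∣ a * u z - 1 := by
    have := Int.isCoprime_iff_gcd_eq_one.mpr hu
    obtain ⟨a, b, hab⟩ := this
    exact ⟨a, -b, by linear_combination hab⟩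
  have hex : ∀ i j, ∃ x, i ≠ z → G i j + (-(a * u i)) * G z j = N * x := by
    intro i j
    obtain ⟨p, hp⟩ := hG i j
    obtain ⟨q, hq⟩ := hG z j
    obtain ⟨r, hr⟩ := ha
    refine ⟨p - a * u i * q - r * u i * v j, fun _ => ?_⟩
    linear_combination hp - a * u i * hq - u i * v j * hr
  choose X hX using hex
  let w : Fin k → ℤ := fun i => if i = z then 1 else N
  let H : Matrix (Fin k) (Fin k) ℤ := of fun i j => if i = z then G z j else X i j
  have h1 : det (of fun i j => w i * H i j) = G.det := by
    refine det_eq_of_forall_row_eq_smul_add_const (fun i => if i = z then 0 else -(a * u i)) z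
      (by simp) ?_
    intro i j
    by_cases hi : i = z
    · subst hi; simp [w, H]
    · simp only [of_apply, w, H, hi, if_false]
      exact (hX i j hi).symm
  rw [← h1, det_mul_column]
  have : ∏ i, w i = N ^ (k - 1) := by
    simp [w, Finset.prod_ite, Finset.filter_ne']
  rw [this]
  exact dvd_mul_right _ _

section
variable {d k : ℕ} {c : Matrix (Fin k) (Fin (d + 1)) ℤ}

theorem aux_vecMul (hindep : LinearIndependent ℚ fun i => fun j => ((c i j : ℚ)))
    (v : Fin k → ℤ) (hv : v ᵥ* c = 0) : v = 0 := by
  rw [Fintype.linearIndependent_iff] at hindep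
  have := hindep (fun i => (v i : ℚ)) (by
    ext j
    have := congrFun hv j
    simp only [vecMul, dotProduct, Pi.zero_apply] at this
    simp only [Finset.sum_apply, Pi.smul_apply, smul_eq_mul, Pi.zero_apply]
    exact_mod_cast this)
  ext i
  exact_mod_cast this i

theorem aux_range (hindep : LinearIndependent ℚ fun i => fun j => ((c i j : ℚ))) :
    Module.finrank ℤ (LinearMap.range c.mulVecLin) = k := by
  apply le_antisymm
  · simpa using Submodule.finrank_le (LinearMap.range c.mulVecLin)
  · have hinj : Function.Injective (c * cᵀ).mulVecLin := by
      rw [← LinearMap.ker_eq_bot, LinearMap.ker_eq_bot']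
      intro v hv
      apply aux_vecMul hindep
      have hct : cᴴ = cᵀ := by ext; simp
      have h2 : (c * cᴴ) *ᵥ v = 0 := by rw [hct]; exact hv
      rw [self_mul_conjTranspose_mulVec_eq_zero] at h2
      rwa [hct, mulVec_transpose] at h2
    have h1 := LinearMap.finrank_range_of_inj hinj
    have h2 : LinearMap.range (c * cᵀ).mulVecLin ≤ LinearMap.range c.mulVecLin := by
      rw [mulVecLin_mul]
      exact LinearMap.range_comp_le_range _ _
    have h3 := Submodule.finrank_mono h2
    rw [h1] at h3
    simpa using h3

theorem aux_ker (hkd : k ≤ d) (hindep : LinearIndependent ℚ fun i => fun j => ((c i j : ℚ))) :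
    Module.finrank ℤ (LinearMap.ker c.mulVecLin) = d - k + 1 := by
  have h1 := Submodule.finrank_quotient_add_finrank (LinearMap.ker c.mulVecLin)
  rw [(LinearMap.quotKerEquivRange c.mulVecLin).finrank_eq, aux_range hindep] at h1
  simp at h1
  omega

theorem aux_extend (hindep : LinearIndependent ℚ fun i => fun j => ((c i j : ℚ)))
    {n : ℕ} (e : Fin n ⊕ Fin k ≃ Fin (d + 1))
    (D : Matrix (Fin n) (Fin (d + 1)) ℤ) (hD : LinearIndependent ℤ fun i => D i)
    (hspan : Submodule.span ℤ (Set.range fun i => D i) = LinearMap.ker c.mulVecLin) :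
    ∃ E : Matrix (Fin k) (Fin (d + 1)) ℤ, IsUnit ((fromRows D E).submatrix id e).det := by
  let bW : Module.Basis (Fin n) ℤ (LinearMap.ker c.mulVecLin) :=
    (Module.Basis.span hD).map (LinearEquiv.ofEq _ _ hspan)
  have hbW : ∀ i, (bW i : Fin (d + 1) → ℤ) = D i := fun i => by
    simp [bW, Module.Basis.span_apply]
  let bQ : Module.Basis (Fin k) ℤ ((Fin (d + 1) → ℤ) ⧸ LinearMap.ker c.mulVecLin) :=
    (Module.finBasisOfFinrankEq ℤ _ (aux_range hindep)).map
      (LinearMap.quotKerEquivRange c.mulVecLin).symm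
  let b := bW.sumQuot bQ
  refine ⟨of fun i => b (Sum.inr i), ?_⟩
  have h := Module.Basis.isUnit_det (Pi.basisFun ℤ (Fin (d + 1))) (b.reindex e)
  rw [Module.Basis.det_apply] at h
  refine cast (congrArg IsUnit ?_) h
  symm
  rw [← det_submatrix_equiv_self e.symm, ← det_transpose]
  congr 1
  ext i j
  obtain ⟨x, rfl⟩ := e.surjective j
  cases x <;> simp [Module.Basis.toMatrix_apply, b, hbW]

end

theorem aux_rpow (s : ℝ) (hs : 0 < s) (a : ℕ) : (s ^ ((a : ℝ) / 2)) ^ 2 = s ^ a := by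
  rw [← Real.rpow_natCast, ← Real.rpow_mul hs.le, ← Real.rpow_natCast]
  congr 1
  push_cast
  ring

theorem aux_prodS (d : ℕ) (s : ℝ) : (∏ j : Fin (d + 1), s ^ (j : ℕ)) ^ 2 = s ^ (d * (d + 1)) := by
  rw [Finset.prod_pow_eq_pow_sum, ← pow_mul, Fin.sum_univ_eq_sum_range (fun i => i),
    Finset.sum_range_id_mul_two]
  simp [mul_comm]

set_option maxHeartbeats 2000000 in
/-- Theorem 3.6: let `1 ≤ k ≤ d` and let `c₁,…,c_k ∈ ℤ^{d+1}` be linearly independent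
geometric progressions with common ratio `m` modulo `N`, with `gcd(c_{1,0}, N) = 1`.  Let
`L` be the lattice they span and `S = diag(1, s, …, s^d)` for `s > 0`.  Then `L^⊥_S` has
dimension `d − k + 1`, and for any basis matrix `D` of `L^⊥ = ker(C·)` the determinant of
`L^⊥_S` (the square root of the Gram determinant of `D·S`) satisfies
`det(L^⊥_S) ≤ s^{d(d−k+1)/2} · N^{1−k} · Π ‖cᵢ‖_{2,s⁻¹}`. -/
theorem det_bound_gp_lattice (d k : ℕ) (hk1 : 1 ≤ k) (hkd : k ≤ d)
    (N : ℕ) (hN : 0 < N) (m : ℤ) (c : Fin k → Fin (d + 1) → ℤ)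
    (hindep : LinearIndependent ℚ fun i => fun j => ((c i j : ℚ)))
    (hgp : ∀ i : Fin k, ∀ j : Fin (d + 1), (N : ℤ) ∣ (c i j - c i 0 * m ^ (j : ℕ)))
    (hc0 : Int.gcd (c ⟨0, by omega⟩ 0) N = 1) :
    Module.finrank ℤ (LinearMap.ker (Matrix.of fun i j => c i j).mulVecLin) = d - k + 1 ∧
    ∀ s : ℝ, 0 < s →
      ∀ D : Matrix (Fin (d - k + 1)) (Fin (d + 1)) ℤ,
        (LinearIndependent ℤ fun i => D i) →
        Submodule.span ℤ (Set.range fun i => D i)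
            = LinearMap.ker (Matrix.of fun i j => c i j).mulVecLin →
        Real.sqrt (((D.map (Int.cast : ℤ → ℝ)) * Matrix.diagonal (fun j : Fin (d + 1) => s ^ (j : ℕ)) *
            ((D.map (Int.cast : ℤ → ℝ)) * Matrix.diagonal (fun j : Fin (d + 1) => s ^ (j : ℕ)))ᵀ).det)
          ≤ s ^ (((d * (d - k + 1) : ℕ) : ℝ) / 2) * (N : ℝ) ^ ((1 : ℤ) - (k : ℤ)) *
            ∏ i : Fin k, vecSkewNormInv d (c i) s := by
  have hker := aux_ker (c := Matrix.of fun i j => c i j) hkd hindep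
  refine ⟨hker, ?_⟩
  intro s hs D hD hspan
  have hcard : (d - k + 1) + k = d + 1 := by omega
  let e : Fin (d - k + 1) ⊕ Fin k ≃ Fin (d + 1) := finSumFinEquiv.trans (finCongr hcard)
  set C : Matrix (Fin k) (Fin (d + 1)) ℤ := Matrix.of fun i j => c i j with hC
  obtain ⟨E, hE⟩ := aux_extend (c := C) hindep e D hD hspan
  set S : Matrix (Fin (d + 1)) (Fin (d + 1)) ℝ :=
    Matrix.diagonal (fun j : Fin (d + 1) => s ^ (j : ℕ)) with hS
  let T : Matrix (Fin (d + 1)) (Fin (d + 1)) ℝ :=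
    Matrix.diagonal (fun j : Fin (d + 1) => (s⁻¹) ^ (j : ℕ))
  have hTS : T * Sᵀ = 1 := by
    rw [hS, diagonal_transpose, diagonal_mul_diagonal, ← diagonal_one]
    congr 1
    ext j
    rw [← mul_pow, inv_mul_cancel₀ hs.ne', one_pow]
  have hmul : ∀ {n : ℕ} (F : Matrix (Fin n) (Fin (d + 1)) ℤ),
      (C.map (Int.cast : ℤ → ℝ) * T) * (F.map (Int.cast : ℤ → ℝ) * S)ᵀ =
        (C * Fᵀ).map (Int.cast : ℤ → ℝ) := by
    intro n F
    rw [transpose_mul, Matrix.mul_assoc, ← Matrix.mul_assoc T, hTS, Matrix.one_mul]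
    ext i j
    simp [Matrix.mul_apply]
  have hCD : C * Dᵀ = 0 := by
    ext i j
    have : D j ∈ LinearMap.ker C.mulVecLin := by
      rw [← hspan]
      exact Submodule.subset_span ⟨j, rfl⟩
    rw [LinearMap.mem_ker] at this
    have := congrFun this i
    simpa [Matrix.mul_apply, mulVec, dotProduct] using this
  have key := aux_key e (D.map (Int.cast : ℤ → ℝ) * S) (E.map (Int.cast : ℤ → ℝ) * S)
    (C.map (Int.cast : ℤ → ℝ) * T) (by rw [hmul, hCD]; ext; simp)
  rw [hmul] at key
  set P := ((D.map (Int.cast : ℤ → ℝ) * S) * (D.map (Int.cast : ℤ → ℝ) * S)ᵀ).det with hP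
  set G := C * Eᵀ with hG
  have hdetG : (G.map (Int.cast : ℤ → ℝ)).det = (G.det : ℝ) := by
    have := (Int.castRingHom ℝ).map_det G
    simpa [RingHom.mapMatrix_apply] using this.symm
  -- the unimodular factor
  have hU : (((fromRows (D.map (Int.cast : ℤ → ℝ) * S) (E.map (Int.cast : ℤ → ℝ) * S)).submatrix
      id e).det) ^ 2 = s ^ (d * (d + 1)) := by
    have h1 : (fromRows (D.map (Int.cast : ℤ → ℝ) * S) (E.map (Int.cast : ℤ → ℝ) * S)).submatrix
        id e = (((fromRows D E).submatrix id e).map (Int.cast : ℤ → ℝ)) * S.submatrix e e := by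
      ext i j
      cases i <;> simp [hS, Matrix.mul_apply, diagonal_apply]
    have h2 : (((fromRows D E).submatrix id e).map (Int.cast : ℤ → ℝ)).det =
        (((fromRows D E).submatrix id e).det : ℝ) := by
      have := (Int.castRingHom ℝ).map_det ((fromRows D E).submatrix id e)
      simpa [RingHom.mapMatrix_apply] using this.symm
    rw [h1, det_mul, h2, det_submatrix_equiv_self, hS, det_diagonal, mul_pow, aux_prodS]
    rcases Int.isUnit_iff.mp hE with h | h <;> simp [h]
  rw [hU, hdetG] at key
  -- divisibility
  have hdvd : (N : ℤ) ^ (k - 1) ∣ G.det := by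
    refine aux_dvd (by omega) (N : ℤ) G (fun i => c i 0) (fun l => ∑ j : Fin (d + 1), m ^ (j : ℕ) * E l j) ?_ hc0
    intro i l
    have : G i l - c i 0 * ∑ j : Fin (d + 1), m ^ (j : ℕ) * E l j =
        ∑ j : Fin (d + 1), (c i j - c i 0 * m ^ (j : ℕ)) * E l j := by
      simp only [hG, hC, Matrix.mul_apply, of_apply, transpose_apply, Finset.mul_sum,
        ← Finset.sum_sub_distrib]
      refine Finset.sum_congr rfl fun j _ => by ring
    rw [this]
    exact Finset.dvd_sum fun j _ => (hgp i j).mul_right _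
  have hG0 : G.det ≠ 0 := by
    intro h0
    obtain ⟨v, hv0, hv⟩ := exists_vecMul_eq_zero_iff.mpr h0
    apply hv0
    apply aux_vecMul (c := C) hindep
    have h1 : (v ᵥ* C) ᵥ* Dᵀ = 0 := by rw [vecMul_vecMul, hCD, vecMul_zero]
    have h2 : (v ᵥ* C) ᵥ* Eᵀ = 0 := by rw [vecMul_vecMul]; exact hv
    set w := v ᵥ* C
    have h3 : (fromRows D E) *ᵥ w = 0 := by
      rw [vecMul_transpose] at h1 h2
      rw [fromRows_mulVec, h1, h2]
      ext i; cases i <;> rfl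
    have h4 : ((fromRows D E).submatrix id e) *ᵥ (w ∘ e) = 0 := by
      rw [submatrix_mulVec_equiv]
      simpa [Function.comp_assoc] using h3
    have h5 : w ∘ e = 0 := by
      by_contra hne
      exact hE.ne_zero (exists_mulVec_eq_zero_iff.mp ⟨_, hne, h4⟩)
    ext j
    have := congrFun h5 (e.symm j)
    simpa using this
  have hNG : ((N : ℝ) ^ (k - 1)) ^ 2 ≤ (G.det : ℝ) ^ 2 := by
    have h1 := Int.le_of_dvd (abs_pos.mpr hG0) ((dvd_abs _ _).mpr hdvd)
    have h2 : ((N : ℝ) ^ (k - 1)) ≤ |(G.det : ℝ)| := by exact_mod_cast h1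
    rw [← sq_abs (G.det : ℝ)]
    gcongr
  have hhad := aux_hadamard2 (C.map (Int.cast : ℤ → ℝ) * T)
  set Q := ((C.map (Int.cast : ℤ → ℝ) * T) * (C.map (Int.cast : ℤ → ℝ) * T)ᵀ).det
  have hdiag : ∀ i, ((C.map (Int.cast : ℤ → ℝ) * T) * (C.map (Int.cast : ℤ → ℝ) * T)ᵀ) i i =
      ∑ j : Fin (d + 1), (c i j : ℝ) ^ 2 * (s⁻¹) ^ (2 * (j : ℕ)) := by
    intro i
    rw [Matrix.mul_apply]
    refine Finset.sum_congr rfl fun j _ => ?_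
    simp only [T, transpose_apply, mul_diagonal, map_apply, hC, of_apply]
    ring
  simp only [hdiag] at hhad
  have hvn : ∀ i, 0 ≤ vecSkewNormInv d (c i) s := fun i => by
    unfold vecSkewNormInv; positivity
  have hNpos : (0 : ℝ) < N := by exact_mod_cast hN
  have hR0 : 0 ≤ s ^ (((d * (d - k + 1) : ℕ) : ℝ) / 2) * (N : ℝ) ^ ((1 : ℤ) - (k : ℤ)) *
      ∏ i : Fin k, vecSkewNormInv d (c i) s :=
    mul_nonneg (by positivity) (Finset.prod_nonneg fun i _ => hvn i)
  rw [Real.sqrt_le_left hR0]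
  by_cases hP0 : P ≤ 0
  · exact hP0.trans (sq_nonneg _)
  push Not at hP0
  have key2 : P * (G.det : ℝ) ^ 2 = s ^ (d * (d + 1)) * Q := by
    apply mul_left_cancel₀ hP0.ne'
    linear_combination key
  have hsq : (∏ i : Fin k, vecSkewNormInv d (c i) s) ^ 2 = s ^ (d * k) *
      ∏ i : Fin k, ∑ j : Fin (d + 1), (c i j : ℝ) ^ 2 * (s⁻¹) ^ (2 * (j : ℕ)) := by
    rw [← Finset.prod_pow]
    have : ∀ i : Fin k, vecSkewNormInv d (c i) s ^ 2 =
        s ^ d * ∑ j : Fin (d + 1), (c i j : ℝ) ^ 2 * (s⁻¹) ^ (2 * (j : ℕ)) := fun i => by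
      unfold vecSkewNormInv
      rw [mul_pow, aux_rpow s hs, Real.sq_sqrt (by positivity)]
    simp only [this, Finset.prod_mul_distrib, Finset.prod_const, Finset.card_univ,
      Fintype.card_fin, pow_mul]
  have hNz : (N : ℝ) ^ ((1 : ℤ) - (k : ℤ)) = ((N : ℝ) ^ (k - 1))⁻¹ := by
    rw [← zpow_natCast, ← _root_.zpow_neg]
    congr 1
    omega
  rw [mul_pow, mul_pow, aux_rpow s hs, hsq, hNz]
  have hM : 0 < ((N : ℝ) ^ (k - 1)) ^ 2 := by positivity
  have hexp : s ^ (d * (d - k + 1)) * s ^ (d * k) = s ^ (d * (d + 1)) := by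
    rw [← pow_add, ← mul_add, hcard]
  have hle : P * ((N : ℝ) ^ (k - 1)) ^ 2 ≤ s ^ (d * (d + 1)) *
      ∏ i : Fin k, ∑ j : Fin (d + 1), (c i j : ℝ) ^ 2 * (s⁻¹) ^ (2 * (j : ℕ)) :=
    (mul_le_mul_of_nonneg_left hNG hP0.le).trans
      (key2.le.trans (mul_le_mul_of_nonneg_left hhad (by positivity)))
  rw [← le_div_iff₀ hM, ← hexp] at hle
  refine hle.trans (le_of_eq ?_)
  rw [inv_pow]
  field_simp
end
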